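/- arXiv:2401.05046 — 2 statements merged into one kernel-verified Lean document; each statement's English description precedes it below -/
import Mathlib

section
/- Let G be a finitely generated virtually abelian group with finite generating set S, containing a torsion-free abelian normal subgroup N of finite index with N ≅ Z^n, and let φ ∈ End(G) with φ(N) ⊆ N. Then the twisted conjugacy growth function f_R^S and the twisted conjugacy quotient growth function f_Q are quasi-equivalent, f_R^S ∼ f_Q; moreover f_R^S(k) = Θ(f_Q(k)) = Θ(k^{rank(N) − m}) as k → ∞, where m = min over cosets gN ∈ G/N of rank(Id_N − (τ_g ∘ φ)|_N). -/
open Filter Topology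
open scoped Pointwise NNReal

/-- The ball of radius `r` in a group `G` with respect to a generating set `S`:
elements expressible as a product of at most `r` elements of `S ∪ S⁻¹`. -/
def ball {G : Type*} [Group G] (S : Set G) (r : ℕ) : Set G :=
  {g | ∃ l : List G, l.length ≤ r ∧ (∀ x ∈ l, x ∈ S ∪ S⁻¹) ∧ l.prod = g}

/-- `x` and `y` are `φ`-twisted conjugate: `∃ z, x = z * y * (φ z)⁻¹`. -/
def TwistedConj {G : Type*} [Group G] (φ : G →* G) (x y : G) : Prop :=
  ∃ z : G, x = z * y * (φ z)⁻¹

/-- The `φ`-twisted conjugacy class of `g`. -/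
def twistedConjClass {G : Type*} [Group G] (φ : G →* G) (g : G) : Set G :=
  {x | TwistedConj φ x g}

/-- The twisted conjugacy growth function `f_R^S`: the number of `φ`-twisted conjugacy
classes meeting the ball of radius `r`. -/
noncomputable def fR {G : Type*} [Group G] (φ : G →* G) (S : Set G) (r : ℕ) : ℕ :=
  Nat.card {C : Set G | ∃ g ∈ ball S r, C = twistedConjClass φ g}

/-- The word growth function `β_G^S`. -/
noncomputable def wordGrowth {G : Type*} [Group G] (S : Set G) (r : ℕ) : ℕ :=
  Nat.card (ball S r)

/-- `f = Θ(g)` as `r → ∞`: there are `c₁, c₂ > 0` and `n₀ ∈ ℕ_{>0}` with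
`c₁ g(r) ≤ f(r) ≤ c₂ g(r)` for all `r ≥ n₀`. -/
def IsThetaNat (f g : ℕ → ℕ) : Prop :=
  ∃ c₁ c₂ : ℝ, 0 < c₁ ∧ 0 < c₂ ∧ ∃ n₀ : ℕ, 0 < n₀ ∧
    ∀ r : ℕ, n₀ ≤ r → c₁ * (g r : ℝ) ≤ (f r : ℝ) ∧ (f r : ℝ) ≤ c₂ * (g r : ℝ)

/-- `g` quasi-dominates `f`: there are `b, c > 0` with `f(r) ≤ c g(cr + b) + b` for all `r`
(the `ℕ → ℕ` functions being extended to `ℝ_{≥0}` by flooring the argument). -/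
def QuasiDomNat (f g : ℕ → ℕ) : Prop :=
  ∃ b c : ℝ, 0 < b ∧ 0 < c ∧ ∀ r : ℕ, (f r : ℝ) ≤ c * (g ⌊c * (r : ℝ) + b⌋₊ : ℝ) + b

/-- `f` and `g` are quasi-equivalent. -/
def QuasiEquivNat (f g : ℕ → ℕ) : Prop := QuasiDomNat f g ∧ QuasiDomNat g f

/-- The rank of a subgroup `H` of `G`: the largest `n` such that the free abelian group
`ℤⁿ` embeds into `H`. For a finitely generated free abelian group this is its rank. -/
noncomputable def grpRank {G : Type*} [Group G] (H : Subgroup G) : ℕ :=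
  sSup {n : ℕ | ∃ f : Multiplicative (Fin n → ℤ) →* G, Function.Injective f ∧ ∀ v, f v ∈ H}

/-- The image of the endomorphism `Id_N - (τ_g ∘ φ)|_N` of `N`, written multiplicatively:
the subgroup generated by `{x * (g * φ x * g⁻¹)⁻¹ : x ∈ N}` (this set is already a subgroup
when `N` is abelian, normal and `φ`-invariant). -/
def twistImage {G : Type*} [Group G] (φ : G →* G) (N : Subgroup G) (g : G) : Subgroup G :=
  Subgroup.closure {y | ∃ x ∈ N, y = x * (g * φ x * g⁻¹)⁻¹}

/-- The minimum over the cosets `gN ∈ G/N` of `rank(Id_N - (τ_g ∘ φ)|_N)`. -/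
noncomputable def minTwistRank {G : Type*} [Group G] (φ : G →* G) (N : Subgroup G) : ℕ :=
  sInf {m : ℕ | ∃ g : G, m = grpRank (twistImage φ N g)}

/-- The subgroup `kN` of `G` (corresponding to `(kℤ)ⁿ` when `N ≅ ℤⁿ`): the subgroup
generated by the `k`-th powers of elements of `N`. -/
def powSubgroup {G : Type*} [Group G] (N : Subgroup G) (k : ℕ) : Subgroup G :=
  Subgroup.closure {y | ∃ x ∈ N, y = x ^ k}

/-- The twisted conjugacy quotient growth function: `f_Q(k)` is the Reidemeister number of the
endomorphism induced by `φ` on the quotient `G/kN`, counted as the number of equivalence classes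
on `G` of the lifted twisted conjugacy relation. -/
noncomputable def fQ {G : Type*} [Group G] (φ : G →* G) (N : Subgroup G) (k : ℕ) : ℕ :=
  Nat.card {C : Set G | ∃ g : G,
    C = {x | ∃ z : G, (z * g * (φ z)⁻¹)⁻¹ * x ∈ powSubgroup N k}}

theorem exists_split_projection {n : ℕ} (L : Submodule ℤ (Fin n → ℤ)) :
    ∃ (p : (Fin n → ℤ) →ₗ[ℤ] (Fin (n - Module.finrank ℤ L) → ℤ))
      (s : (Fin (n - Module.finrank ℤ L) → ℤ) →ₗ[ℤ] (Fin n → ℤ)) (F : Finset (Fin n → ℤ)),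
      (∀ a, p (s a) = a) ∧ (∀ v ∈ L, p v = 0) ∧ ∀ v, ∃ f ∈ F, v - s (p v) - f ∈ L := by
  classical
  set T := Submodule.torsion ℤ ((Fin n → ℤ) ⧸ L)
  have hrank : Module.finrank ℤ (((Fin n → ℤ) ⧸ L) ⧸ T) = n - Module.finrank ℤ L := by
    have h1 : Module.finrank ℤ (((Fin n → ℤ) ⧸ L) ⧸ T) = Module.finrank ℤ ((Fin n → ℤ) ⧸ L) := by
      have := rank_quotient_eq_of_le_torsion (R := ℤ) (M' := T) le_rfl
      simp [Module.finrank, this]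
    have h2 := Submodule.finrank_quotient_add_finrank L
    rw [Module.finrank_fin_fun] at h2
    omega
  have hfree : Module.Free ℤ (((Fin n → ℤ) ⧸ L) ⧸ T) := inferInstance
  let b := Module.finBasisOfFinrankEq ℤ (((Fin n → ℤ) ⧸ L) ⧸ T) hrank
  let p := b.equivFun.toLinearMap ∘ₗ T.mkQ ∘ₗ L.mkQ
  have hp : Function.Surjective p :=
    b.equivFun.surjective.comp (T.mkQ_surjective.comp L.mkQ_surjective)
  obtain ⟨s, hs⟩ := Module.projective_lifting_property p LinearMap.id hp
  have hps : ∀ a, p (s a) = a := fun a => LinearMap.congr_fun hs a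
  have : Finite T := Module.finite_of_fg_torsion T (Submodule.torsion_isTorsion)
  have hfin : (Set.range fun τ : T => Quotient.out (τ : (Fin n → ℤ) ⧸ L)).Finite :=
    Set.finite_range _
  refine ⟨p, s, hfin.toFinset, hps, fun v hv => ?_, fun v => ?_⟩
  · have : L.mkQ v = 0 := by simpa using hv
    simp [p, this]
  · have hmem : L.mkQ (v - s (p v)) ∈ T := by
      have : p (v - s (p v)) = 0 := by rw [map_sub, hps, sub_self]
      have h2 : T.mkQ (L.mkQ (v - s (p v))) = 0 := b.equivFun.injective (by simpa [p] using this)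
      exact (Submodule.Quotient.mk_eq_zero T).1 h2
    refine ⟨Quotient.out (L.mkQ (v - s (p v))), ?_, ?_⟩
    · rw [Set.Finite.mem_toFinset]
      exact ⟨⟨_, hmem⟩, rfl⟩
    · rw [← Submodule.Quotient.eq]
      exact (Quotient.out_eq _).symm

/-- The set of elements that are `φ`-twisted conjugate to `g` modulo the subgroup `K`. -/
def twistedClassMod {G : Type*} [Group G] (φ : G →* G) (K : Subgroup G) (g : G) : Set G :=
  {x | ∃ z : G, (z * g * (φ z)⁻¹)⁻¹ * x ∈ K}

/-- The classes of twisted conjugacy modulo `K` that meet the set `B`. -/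
def twistedClassesMod {G : Type*} [Group G] (φ : G →* G) (K : Subgroup G) (B : Set G) :
    Set (Set G) :=
  {C | ∃ g ∈ B, C = twistedClassMod φ K g}

theorem twistedClassMod_bot {G : Type*} [Group G] (φ : G →* G) (g : G) :
    twistedClassMod φ ⊥ g = twistedConjClass φ g := by
  ext x
  simp only [twistedClassMod, twistedConjClass, TwistedConj, Set.mem_ofPred_eq, Subgroup.mem_bot,
    inv_mul_eq_one]
  exact exists_congr fun z => eq_comm

theorem fR_eq_ncard {G : Type*} [Group G] (φ : G →* G) (S : Set G) (r : ℕ) :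
    fR φ S r = (twistedClassesMod φ ⊥ (ball S r)).ncard := by
  simp only [fR, twistedClassesMod, twistedClassMod_bot]
  rfl

theorem fQ_eq_ncard {G : Type*} [Group G] (φ : G →* G) (N : Subgroup G) (k : ℕ) :
    fQ φ N k = (twistedClassesMod φ (powSubgroup N k) Set.univ).ncard := by
  simp only [fQ, twistedClassesMod, twistedClassMod, Set.mem_univ, true_and]
  rfl

theorem self_mem_twistedClassMod {G : Type*} [Group G] (φ : G →* G) (K : Subgroup G) (g : G) :
    g ∈ twistedClassMod φ K g :=
  ⟨1, by simp⟩

theorem twistedClassMod_subset {G : Type*} [Group G] (φ : G →* G) (K : Subgroup G) [hK : K.Normal]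
    {x y w k : G} (hk : k ∈ K) (h : x = w * y * (φ w)⁻¹ * k) :
    twistedClassMod φ K x ⊆ twistedClassMod φ K y := by
  rintro u ⟨z, hz⟩
  refine ⟨z * w, ?_⟩
  have h2 : (z * w * y * (φ (z * w))⁻¹)⁻¹ * u =
      (φ z * k * (φ z)⁻¹) * ((z * x * (φ z)⁻¹)⁻¹ * u) := by
    rw [h, map_mul]; group
  rw [h2]
  exact K.mul_mem (hK.conj_mem _ hk _) hz

theorem twistedClassMod_eq {G : Type*} [Group G] (φ : G →* G) (K : Subgroup G) [hK : K.Normal]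
    {x y w k : G} (hk : k ∈ K) (h : x = w * y * (φ w)⁻¹ * k) :
    twistedClassMod φ K x = twistedClassMod φ K y := by
  refine (twistedClassMod_subset φ K hk h).antisymm
    (twistedClassMod_subset φ K (w := w⁻¹) (k := (φ w)⁻¹ * k⁻¹ * φ w) ?_ ?_)
  · simpa using hK.conj_mem _ (K.inv_mem hk) (φ w)⁻¹
  · rw [h, map_inv]; group

/-- `A` is the matrix of `Id_N - (τ_g ∘ φ)|_N` in the coordinates `ι` of `N`. -/
def IsTwistMap {G : Type*} [Group G] {n : ℕ} (ι : Multiplicative (Fin n → ℤ) →* G)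
    (φ : G →* G) (g : G) (A : (Fin n → ℤ) →ₗ[ℤ] (Fin n → ℤ)) : Prop :=
  ∀ v, ι (.ofAdd (A v)) = ι (.ofAdd v) * (g * φ (ι (.ofAdd v)) * g⁻¹)⁻¹

theorem exists_isTwistMap {G : Type*} [Group G] {n : ℕ} {N : Subgroup G} (hN : N.Normal)
    {ι : Multiplicative (Fin n → ℤ) →* G} (hι : Function.Injective ι) (hr : ι.range = N)
    {φ : G →* G} (hφN : ∀ x ∈ N, φ x ∈ N) (g : G) :
    ∃ A : (Fin n → ℤ) →ₗ[ℤ] (Fin n → ℤ), IsTwistMap ι φ g A := by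
  have hmem : ∀ v, ι v ∈ N := fun v => hr ▸ ⟨v, rfl⟩
  have hex : ∀ v, ∃ w, ι w = g * φ (ι v) * g⁻¹ := fun v => by
    have : g * φ (ι v) * g⁻¹ ∈ ι.range := hr ▸ hN.conj_mem _ (hφN _ (hmem v)) g
    exact this
  choose B hB using hex
  have hBmul : ∀ v w, B (v * w) = B v * B w := fun v w => hι (by
    rw [map_mul, hB, hB, hB, map_mul, map_mul]; group)
  let A : (Fin n → ℤ) →+ (Fin n → ℤ) :=
    AddMonoidHom.mk' (fun v => v - (B (.ofAdd v)).toAdd) fun v w => by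
      simp only [ofAdd_add, hBmul, toAdd_mul]; abel
  refine ⟨A.toIntLinearMap, fun v => ?_⟩
  rw [← hB, ← map_inv, ← map_mul]
  congr 1

theorem IsTwistMap.mul_eq {G : Type*} [Group G] {n : ℕ} {ι : Multiplicative (Fin n → ℤ) →* G}
    {φ : G →* G} {g : G} {A : (Fin n → ℤ) →ₗ[ℤ] (Fin n → ℤ)} (hA : IsTwistMap ι φ g A)
    (y w : Fin n → ℤ) :
    ι (.ofAdd (y + A w)) * g =
      ι (.ofAdd w) * (ι (.ofAdd y) * g) * (φ (ι (.ofAdd w)))⁻¹ := by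
  rw [ofAdd_add, map_mul, hA w]
  have : ι (.ofAdd y) * ι (.ofAdd w) = ι (.ofAdd w) * ι (.ofAdd y) := by
    rw [← map_mul ι, ← map_mul ι, mul_comm]
  calc _ = (ι (.ofAdd y) * ι (.ofAdd w)) * g * (φ (ι (.ofAdd w)))⁻¹ := by group
    _ = _ := by rw [this]; group

/-- Every element is the product of an element of `N` and the chosen representative of its
coset. -/
theorem exists_mul_out_eq {G : Type*} [Group G] {n : ℕ} {N : Subgroup G} (hN : N.Normal)
    {ι : Multiplicative (Fin n → ℤ) →* G} (hr : ι.range = N) (g : G) :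
    ∃ v, ι (.ofAdd v) * Quotient.out (g : G ⧸ N) = g := by
  have h1 : (Quotient.out (g : G ⧸ N))⁻¹ * g ∈ N :=
    QuotientGroup.eq.1 (Quotient.out_eq (g : G ⧸ N) : ((Quotient.out (g : G ⧸ N) : G) : G ⧸ N) = g)
  obtain ⟨v, hv⟩ := hr.ge (hN.mem_comm h1)
  exact ⟨v.toAdd, by rw [ofAdd_toAdd, hv]; group⟩

/-- If each coset is covered, up to twisted conjugacy by `N` and modulo `K`, by few elements, then
there are few twisted conjugacy classes. -/
theorem twistedClassesMod_finite_and_ncard_le {G : Type*} [Group G] {n : ℕ} {N : Subgroup G}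
    (hN : N.Normal) [N.FiniteIndex]
    {ι : Multiplicative (Fin n → ℤ) →* G} (hr : ι.range = N) {φ : G →* G}
    {A : G → (Fin n → ℤ) →ₗ[ℤ] (Fin n → ℤ)} (hA : ∀ g, IsTwistMap ι φ g (A g))
    (K : Subgroup G) [hK : K.Normal] (B : Set G) (c : ℕ)
    (Y : G ⧸ N → Finset (Fin n → ℤ)) (hY : ∀ q, (Y q).card ≤ c)
    (hcov : ∀ q v, ι (.ofAdd v) * Quotient.out q ∈ B →
      ∃ y ∈ Y q, ∃ w k, ι (.ofAdd k) ∈ K ∧ v = y + A (Quotient.out q) w + k) :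
    (twistedClassesMod φ K B).Finite ∧ (twistedClassesMod φ K B).ncard ≤ N.index * c := by
  classical
  have := Fintype.ofFinite (G ⧸ N)
  let E : Finset (Set G) := Finset.univ.biUnion fun q : G ⧸ N =>
    (Y q).image fun y => twistedClassMod φ K (ι (.ofAdd y) * Quotient.out q)
  have hsub : twistedClassesMod φ K B ⊆ E := by
    rintro C ⟨g, hg, rfl⟩
    set q : G ⧸ N := (g : G ⧸ N)
    obtain ⟨v, hg'⟩ := exists_mul_out_eq hN hr g
    obtain ⟨y, hy, w, k, hk, hvy⟩ := hcov q v (hg'.symm ▸ hg)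
    simp only [E, Finset.coe_biUnion, Set.mem_iUnion, Finset.coe_image]
    refine ⟨q, by simp, y, hy, ?_⟩
    refine (twistedClassMod_eq φ K (w := ι (.ofAdd w))
      (k := (Quotient.out q)⁻¹ * ι (.ofAdd k) * Quotient.out q) ?_ ?_).symm
    · simpa using hK.conj_mem _ hk (Quotient.out q)⁻¹
    · rw [← (hA _).mul_eq, ← hg', hvy, ofAdd_add _ k, map_mul ι]; group; rfl
  refine ⟨E.finite_toSet.subset hsub, ?_⟩
  calc (twistedClassesMod φ K B).ncard ≤ (E : Set (Set G)).ncard :=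
        Set.ncard_le_ncard hsub E.finite_toSet
    _ = E.card := Set.ncard_coe_finset E
    _ ≤ Finset.card (Finset.univ : Finset (G ⧸ N)) * c :=
        Finset.card_biUnion_le_card_mul _ _ _ fun q _ => Finset.card_image_le.trans (hY q)
    _ = _ := by rw [Subgroup.index_eq_card, Nat.card_eq_fintype_card, Finset.card_univ]

/-- Elements of a coset that are not twisted conjugate under `N` modulo `K` represent many
twisted conjugacy classes. -/
theorem card_le_index_mul_ncard {G : Type*} [Group G] {n : ℕ} {N : Subgroup G}
    (hN : N.Normal) [N.FiniteIndex]
    {ι : Multiplicative (Fin n → ℤ) →* G} (hι : Function.Injective ι) (hr : ι.range = N)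
    {φ : G →* G} {g : G}
    {A : (Fin n → ℤ) →ₗ[ℤ] (Fin n → ℤ)} (hA : IsTwistMap ι φ g A)
    (K : Subgroup G) [hK : K.Normal] (hKN : K ≤ N) (B : Set G)
    (hfin : (twistedClassesMod φ K B).Finite) (X : Finset (Fin n → ℤ))
    (hXB : ∀ x ∈ X, ι (.ofAdd x) * g ∈ B)
    (hX : ∀ x ∈ X, ∀ y ∈ X, ∀ w k, ι (.ofAdd k) ∈ K →
      x = y + A w + k → x = y) :
    X.card ≤ N.index * (twistedClassesMod φ K B).ncard := by
  classical
  have := Fintype.ofFinite (G ⧸ N)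
  let f : (Fin n → ℤ) → Set G := fun x => twistedClassMod φ K (ι (.ofAdd x) * g)
  have himage : ((X.image f : Finset (Set G)) : Set (Set G)) ⊆ twistedClassesMod φ K B := by
    intro C hC
    obtain ⟨x, hx, rfl⟩ := Finset.mem_image.1 hC
    exact ⟨_, hXB x hx, rfl⟩
  have hfib : ∀ C ∈ X.image f, (X.filter fun x => f x = C).card ≤ N.index := by
    intro C hC
    obtain ⟨x₀, hx₀, rfl⟩ := Finset.mem_image.1 hC
    have hz : ∀ y, f y = f x₀ → ∃ z : G,
        (z * (ι (.ofAdd x₀) * g) * (φ z)⁻¹)⁻¹ * (ι (.ofAdd y) * g) ∈ K := fun y hy => by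
      have h1 : ι (.ofAdd y) * g ∈ f y := self_mem_twistedClassMod φ K _
      rw [hy] at h1
      exact h1
    choose! z hz using hz
    rw [Subgroup.index_eq_card, Nat.card_eq_fintype_card, ← Finset.card_univ]
    refine Finset.card_le_card_of_injOn (fun y => (z y : G ⧸ N)) (fun _ _ => Finset.mem_univ _) ?_
    intro y hy y' hy' hyy
    simp only [Finset.coe_filter, Set.mem_ofPred_eq] at hy hy'
    have hk := hz y hy.2
    have hk' := hz y' hy'.2
    set a := ι (.ofAdd x₀) * g
    have hw : z y' * (z y)⁻¹ ∈ ι.range := by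
      rw [hr]
      exact hN.mem_comm (QuotientGroup.eq.1 hyy)
    obtain ⟨w, hw⟩ := hw
    have hzy' : z y' = ι w * z y := by rw [hw]; group
    set k := (z y * a * (φ (z y))⁻¹)⁻¹ * (ι (.ofAdd y) * g) with hkdef
    set k' := (z y' * a * (φ (z y'))⁻¹)⁻¹ * (ι (.ofAdd y') * g) with hkdef'
    have e1 : ι (.ofAdd y') * g = ι w * (ι (.ofAdd y) * g) * (φ (ι w))⁻¹ *
        ((φ (ι w)) * k⁻¹ * (φ (ι w))⁻¹ * k') := by
      rw [hkdef, hkdef', hzy', map_mul]; group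
    have hmem : (φ (ι w)) * k⁻¹ * (φ (ι w))⁻¹ * k' ∈ K :=
      K.mul_mem (hK.conj_mem _ (K.inv_mem hk) _) hk'
    set κ := (φ (ι w)) * k⁻¹ * (φ (ι w))⁻¹ * k'
    have hκ : g * κ * g⁻¹ ∈ K := hK.conj_mem _ hmem g
    have hκN : g * κ * g⁻¹ ∈ ι.range := hr ▸ hKN hκ
    obtain ⟨u, hu⟩ := hκN
    refine (hX y' hy'.1 y hy.1 w.toAdd u.toAdd (by rw [ofAdd_toAdd, hu]; exact hκ)
      (Multiplicative.ofAdd.injective (hι ?_))).symm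
    have e2 := hA.mul_eq y w.toAdd
    rw [ofAdd_toAdd] at e2
    rw [← e2] at e1
    rw [ofAdd_add _ u.toAdd, map_mul ι, ofAdd_toAdd, hu, ← mul_left_inj g, e1]
    group
  calc X.card ≤ N.index * (X.image f).card := Finset.card_le_mul_card_image X _ hfib
    _ ≤ _ := Nat.mul_le_mul_left _ (by
      rw [← Set.ncard_coe_finset]
      exact Set.ncard_le_ncard himage hfin)

theorem grpRank_twistImage {G : Type*} [Group G] {n : ℕ} {N : Subgroup G}
    {ι : Multiplicative (Fin n → ℤ) →* G} (hι : Function.Injective ι) (hr : ι.range = N)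
    {φ : G →* G} {g : G} {A : (Fin n → ℤ) →ₗ[ℤ] (Fin n → ℤ)} (hA : IsTwistMap ι φ g A) :
    grpRank (twistImage φ N g) = Module.finrank ℤ (LinearMap.range A) := by
  have hset : {y | ∃ x ∈ N, y = x * (g * φ x * g⁻¹)⁻¹} =
      ((AddSubgroup.toSubgroup (LinearMap.range A).toAddSubgroup).map ι : Set G) := by
    ext y
    constructor
    · rintro ⟨x, hx, rfl⟩
      obtain ⟨v, rfl⟩ := hr.ge hx
      exact ⟨.ofAdd (A v.toAdd), ⟨v.toAdd, rfl⟩, by rw [hA, ofAdd_toAdd]⟩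
    · rintro ⟨_, ⟨v, rfl⟩, rfl⟩
      exact ⟨ι (.ofAdd v), hr.le ⟨_, rfl⟩, hA v⟩
  have himage : twistImage φ N g =
      (AddSubgroup.toSubgroup (LinearMap.range A).toAddSubgroup).map ι := by
    rw [twistImage, hset, Subgroup.closure_eq]
  rw [himage, grpRank]
  refine IsGreatest.csSup_eq ⟨?_, ?_⟩
  · let b := Module.finBasis ℤ (LinearMap.range A)
    let j : (Fin (Module.finrank ℤ (LinearMap.range A)) → ℤ) →ₗ[ℤ] (Fin n → ℤ) :=
      (LinearMap.range A).subtype ∘ₗ b.equivFun.symm.toLinearMap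
    refine ⟨ι.comp (AddMonoidHom.toMultiplicative j.toAddMonoidHom), ?_, fun v => ?_⟩
    · exact hι.comp (Subtype.val_injective.comp b.equivFun.symm.injective)
    · exact ⟨_, (b.equivFun.symm v.toAdd).2, rfl⟩
  · rintro m ⟨f, hf, hfmem⟩
    choose F hF hFf using hfmem
    have hFmul : ∀ v w, F (v * w) = F v * F w := fun v w => hι (by simp only [map_mul, hFf])
    let j : (Fin m → ℤ) →+ LinearMap.range A :=
      AddMonoidHom.mk' (fun v => ⟨(F (.ofAdd v)).toAdd, hF _⟩) fun v w => by
        ext1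
        simp only [ofAdd_add, hFmul, toAdd_mul, Submodule.coe_add]
    have hj : Function.Injective j.toIntLinearMap := fun v w h => by
      have h1 : F (.ofAdd v) = F (.ofAdd w) :=
        congrArg (fun u : LinearMap.range A => (u : Fin n → ℤ)) h
      have h2 : f (.ofAdd v) = f (.ofAdd w) := by rw [← hFf, ← hFf, h1]
      exact hf h2
    simpa using LinearMap.finrank_le_finrank_of_injective hj

theorem mem_powSubgroup {G : Type*} [Group G] {n : ℕ} {N : Subgroup G}
    {ι : Multiplicative (Fin n → ℤ) →* G} (hr : ι.range = N) (k : ℕ) {x : G} :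
    x ∈ powSubgroup N k ↔ ∃ v, x = ι (.ofAdd ((k : ℤ) • v)) := by
  constructor
  · intro hx
    induction hx using Subgroup.closure_induction with
    | mem x hx =>
      obtain ⟨y, hy, rfl⟩ := hx
      obtain ⟨v, rfl⟩ := hr.ge hy
      refine ⟨v.toAdd, ?_⟩
      rw [ofAdd_zsmul, ofAdd_toAdd, zpow_natCast, map_pow]
    | one => exact ⟨0, by simp⟩
    | mul x y _ _ hx hy =>
      obtain ⟨v, rfl⟩ := hx
      obtain ⟨w, rfl⟩ := hy
      exact ⟨v + w, by rw [smul_add, ofAdd_add, map_mul]⟩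
    | inv x _ hx =>
      obtain ⟨v, rfl⟩ := hx
      exact ⟨-v, by rw [smul_neg, ofAdd_neg, map_inv]⟩
  · rintro ⟨v, rfl⟩
    refine Subgroup.subset_closure ⟨ι (.ofAdd v), hr.le ⟨_, rfl⟩, ?_⟩
    rw [ofAdd_zsmul, zpow_natCast, map_pow]

theorem powSubgroup_le {G : Type*} [Group G] (N : Subgroup G) (k : ℕ) : powSubgroup N k ≤ N := by
  rw [powSubgroup, Subgroup.closure_le]
  rintro _ ⟨x, hx, rfl⟩
  exact N.pow_mem hx k

theorem powSubgroup_normal {G : Type*} [Group G] {N : Subgroup G} (hN : N.Normal) (k : ℕ) :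
    (powSubgroup N k).Normal := by
  refine ⟨fun x hx g => ?_⟩
  induction hx using Subgroup.closure_induction with
  | mem x hx =>
    obtain ⟨y, hy, rfl⟩ := hx
    exact Subgroup.subset_closure ⟨g * y * g⁻¹, hN.conj_mem y hy g, by rw [conj_pow]⟩
  | one => simp
  | mul x y _ _ hx hy => simpa [mul_assoc] using mul_mem hx hy
  | inv x _ hx => simpa [mul_assoc] using inv_mem hx

theorem ball_mono {G : Type*} [Group G] (S : Set G) {r s : ℕ} (h : r ≤ s) : ball S r ⊆ ball S s :=
  fun _ ⟨l, hl, hl'⟩ => ⟨l, hl.trans h, hl'⟩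

theorem one_mem_ball {G : Type*} [Group G] (S : Set G) (r : ℕ) : 1 ∈ ball S r :=
  ⟨[], by simp, by simp, by simp⟩

theorem mul_mem_ball {G : Type*} [Group G] {S : Set G} {r s : ℕ} {x y : G} (hx : x ∈ ball S r)
    (hy : y ∈ ball S s) : x * y ∈ ball S (r + s) := by
  obtain ⟨l, hl, hlS, rfl⟩ := hx
  obtain ⟨l', hl', hlS', rfl⟩ := hy
  refine ⟨l ++ l', by simpa using add_le_add hl hl', fun z hz => ?_, by simp⟩
  exact (List.mem_append.1 hz).elim (hlS z) (hlS' z)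

theorem npow_mem_ball {G : Type*} [Group G] {S : Set G} {r : ℕ} {x : G} (hx : x ∈ ball S r)
    (m : ℕ) : x ^ m ∈ ball S (r * m) := by
  induction m with
  | zero => simpa using one_mem_ball S 0
  | succ m ih => simpa [pow_succ, mul_add] using mul_mem_ball ih hx

theorem exists_mem_ball {G : Type*} [Group G] {S : Set G} (hS : Subgroup.closure S = ⊤) (g : G) :
    ∃ r, g ∈ ball S r := by
  have hg : g ∈ Submonoid.closure (S ∪ S⁻¹) := by
    rw [← Subgroup.closure_toSubmonoid, hS]
    trivial
  obtain ⟨l, hl, hlg⟩ := Submonoid.exists_list_of_mem_closure hg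
  exact ⟨l.length, l, le_rfl, hl, hlg⟩

/-- Points of a box of side `m` in a finitely generated abelian subgroup have word length linear
in `m`. -/
theorem exists_box_mem_ball {G : Type*} [Group G] {S : Set G} (hS : Subgroup.closure S = ⊤)
    {d : ℕ} (h : Multiplicative (Fin d → ℤ) →* G) :
    ∃ c : ℕ, ∀ (m : ℕ) (a : Fin d → ℤ), (∀ j, 0 ≤ a j ∧ a j ≤ m) →
      h (.ofAdd a) ∈ ball S (c * m) := by
  classical
  suffices H : ∀ J : Finset (Fin d), ∃ c : ℕ, ∀ (m : ℕ) (a : Fin d → ℤ),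
      (∀ j, 0 ≤ a j ∧ a j ≤ m) →
      h (.ofAdd (∑ j ∈ J, Pi.single j (a j))) ∈ ball S (c * m) by
    obtain ⟨c, hc⟩ := H Finset.univ
    refine ⟨c, fun m a ha => ?_⟩
    have := hc m a ha
    rwa [Finset.univ_sum_single] at this
  intro J
  induction J using Finset.induction_on with
  | empty => exact ⟨0, fun m a _ => by simpa using one_mem_ball S 0⟩
  | insert j J hj ih =>
    obtain ⟨c, hc⟩ := ih
    obtain ⟨r, hr⟩ := exists_mem_ball hS (h (.ofAdd (Pi.single j 1)))
    refine ⟨r + c, fun m a ha => ?_⟩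
    rw [Finset.sum_insert hj, ofAdd_add, map_mul, add_mul]
    refine mul_mem_ball ?_ (hc m a ha)
    obtain ⟨b, hb⟩ := Int.eq_ofNat_of_zero_le (ha j).1
    have hbm : b ≤ m := by have := (ha j).2; omega
    have hs : (Pi.single j (a j) : Fin d → ℤ) = b • Pi.single j 1 := by
      rw [hb, ← Pi.single_smul]; simp
    rw [hs, ofAdd_nsmul, map_pow]
    exact ball_mono S (Nat.mul_le_mul_left r hbm) (npow_mem_ball hr b)

/-- The `N`-component of an element of the ball of radius `r` is bounded linearly in `r`. -/
theorem exists_bound_of_mem_ball {G : Type*} [Group G] {S : Set G} (hS : S.Finite)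
    {n : ℕ} {N : Subgroup G} (hN : N.Normal) [N.FiniteIndex]
    {ι : Multiplicative (Fin n → ℤ) →* G} (hι : Function.Injective ι) (hr : ι.range = N)
    {d : ℕ} (p : (Fin n → ℤ) →ₗ[ℤ] (Fin d → ℤ)) :
    ∃ c : ℕ, ∀ (r : ℕ) (q : G ⧸ N) (v : Fin n → ℤ), ι (.ofAdd v) * Quotient.out q ∈ ball S r →
      ∀ j, |p v j| ≤ c * (r + 1) := by
  choose x hx using exists_mul_out_eq hN hr
  have hxq : ∀ (q : G ⧸ N) v, x (ι (.ofAdd v) * Quotient.out q) = v := fun q v => by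
    have hq : ((ι (.ofAdd v) * Quotient.out q : G) : G ⧸ N) = q := by
      have h1 : ((ι (.ofAdd v) : G) : G ⧸ N) = 1 :=
        (QuotientGroup.eq_one_iff _).2 (hr.le ⟨_, rfl⟩)
      rw [QuotientGroup.mk_mul, h1, one_mul]
      exact Quotient.out_eq q
    have h2 := hx (ι (.ofAdd v) * Quotient.out q)
    rw [hq, mul_left_inj] at h2
    exact Multiplicative.ofAdd.injective (hι h2)
  have hxmul : ∀ g s : G, x (g * s) = x g + x (Quotient.out (g : G ⧸ N) * s) := fun g s => by
    rw [← hxq ((Quotient.out (g : G ⧸ N) * s : G) : G ⧸ N)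
      (x g + x (Quotient.out (g : G ⧸ N) * s)), ofAdd_add, map_mul, mul_assoc, hx, ← mul_assoc, hx]
  have : Finite (S ∪ S⁻¹ : Set G) := (hS.union hS.inv).to_subtype
  obtain ⟨c₁, hc₁⟩ := Finite.exists_le fun i : (G ⧸ N) × (S ∪ S⁻¹ : Set G) × Fin d =>
    |p (x (Quotient.out i.1 * i.2.1)) i.2.2|
  obtain ⟨c₀, hc₀⟩ := Finite.exists_le fun j : Fin d => |p (x 1) j|
  have key : ∀ l : List G, (∀ y ∈ l, y ∈ S ∪ S⁻¹) → ∀ j,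
      |p (x l.prod) j| ≤ ((c₀.toNat + c₁.toNat : ℕ) : ℤ) * (l.length + 1) := by
    intro l
    induction l using List.reverseRecOn with
    | nil =>
      intro _ j
      simp only [List.prod_nil, List.length_nil]
      push_cast
      have := Int.self_le_toNat c₀
      have := Int.self_le_toNat c₁
      linarith [hc₀ j, Int.natCast_nonneg c₁.toNat]
    | append_singleton l s ih =>
      intro hl j
      have h1 := ih (fun y hy => hl y (by simp [hy])) j
      have h2 := hc₁ ((l.prod : G ⧸ N), ⟨s, hl s (by simp)⟩, j)
      simp only at h2
      rw [List.prod_append, List.prod_singleton, hxmul, map_add, Pi.add_apply, List.length_append,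
        List.length_singleton]
      refine (abs_add_le _ _).trans ((add_le_add h1 h2).trans ?_)
      have := Int.self_le_toNat c₁
      push_cast
      linarith [Int.natCast_nonneg c₀.toNat]
  refine ⟨c₀.toNat + c₁.toNat, fun r q v ⟨l, hl, hlS, hlv⟩ j => ?_⟩
  have h1 := key l hlS j
  rw [hlv, hxq] at h1
  refine h1.trans ?_
  gcongr

/-- If every coset of `N` is covered, up to twisted conjugacy, by `O(r ^ d)` elements, then there
are `O(r ^ d)` twisted conjugacy classes. -/
theorem exists_ncard_le_mul_pow {G : Type*} [Group G] {n : ℕ} {N : Subgroup G}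
    (hN : N.Normal) [N.FiniteIndex]
    {ι : Multiplicative (Fin n → ℤ) →* G} (hr : ι.range = N) {φ : G →* G}
    {A : G → (Fin n → ℤ) →ₗ[ℤ] (Fin n → ℤ)} (hA : ∀ g, IsTwistMap ι φ g (A g))
    (K : ℕ → Subgroup G) (hK : ∀ r, (K r).Normal) (B : ℕ → Set G) (d : ℕ)
    (hcov : ∀ q : G ⧸ N, ∃ c : ℕ, ∀ r, 0 < r → ∃ Y : Finset (Fin n → ℤ), Y.card ≤ c * r ^ d ∧
      ∀ v, ι (.ofAdd v) * Quotient.out q ∈ B r →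
        ∃ y ∈ Y, ∃ w k, ι (.ofAdd k) ∈ K r ∧ v = y + A (Quotient.out q) w + k) :
    ∃ c : ℕ, ∀ r, 0 < r → (twistedClassesMod φ (K r) (B r)).Finite ∧
      (twistedClassesMod φ (K r) (B r)).ncard ≤ c * r ^ d := by
  choose c hc using hcov
  obtain ⟨M, hM⟩ := Finite.exists_le c
  refine ⟨N.index * M, fun r hr0 => ?_⟩
  choose Y hY hYcov using fun q => hc q r hr0
  have := hK r
  have h := twistedClassesMod_finite_and_ncard_le hN hr hA (K r) (B r) (M * r ^ d) Y
    (fun q => (hY q).trans (Nat.mul_le_mul_right _ (hM q))) hYcov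
  rwa [← mul_assoc] at h

/-- The translates by `F` of the image of a finite set of lattice points under `s`. -/
theorem exists_image_add_finset {n d : ℕ} (s : (Fin d → ℤ) →ₗ[ℤ] (Fin n → ℤ))
    (F : Finset (Fin n → ℤ)) (I : Finset ℤ) :
    ∃ Y : Finset (Fin n → ℤ), Y.card ≤ F.card * I.card ^ d ∧
      ∀ a, (∀ j, a j ∈ I) → ∀ f ∈ F, s a + f ∈ Y := by
  classical
  refine ⟨Finset.image₂ (fun a f => s a + f) (Fintype.piFinset fun _ => I) F, ?_, ?_⟩
  · refine (Finset.card_image₂_le _ _ _).trans ?_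
    simp [mul_comm]
  · intro a ha f hf
    exact Finset.mem_image₂_of_mem (Fintype.mem_piFinset.2 ha) hf

theorem exists_fR_le {G : Type*} [Group G] {S : Set G} (hS : S.Finite)
    {n : ℕ} {N : Subgroup G} (hN : N.Normal) [N.FiniteIndex]
    {ι : Multiplicative (Fin n → ℤ) →* G} (hι : Function.Injective ι) (hr : ι.range = N)
    {φ : G →* G} {A : G → (Fin n → ℤ) →ₗ[ℤ] (Fin n → ℤ)} (hA : ∀ g, IsTwistMap ι φ g (A g))
    {d : ℕ} (hd : ∀ g, n - Module.finrank ℤ (LinearMap.range (A g)) ≤ d) :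
    ∃ c : ℕ, ∀ r, 0 < r → (twistedClassesMod φ ⊥ (ball S r)).Finite ∧
      (twistedClassesMod φ ⊥ (ball S r)).ncard ≤ c * r ^ d := by
  refine exists_ncard_le_mul_pow hN hr hA (fun _ => ⊥) (fun _ => inferInstance) (ball S) d
    fun q => ?_
  obtain ⟨p, s, F, -, -, hF⟩ := exists_split_projection (LinearMap.range (A (Quotient.out q)))
  obtain ⟨C, hC⟩ := exists_bound_of_mem_ball hS hN hι hr p
  refine ⟨F.card * (4 * C + 1) ^ d, fun r hr0 => ?_⟩
  obtain ⟨Y, hYcard, hY⟩ := exists_image_add_finset s F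
    (Finset.Icc (-((C * (r + 1) : ℕ) : ℤ)) ((C * (r + 1) : ℕ) : ℤ))
  refine ⟨Y, hYcard.trans ?_, fun v hv => ?_⟩
  · have hcard : (Finset.Icc (-((C * (r + 1) : ℕ) : ℤ)) ((C * (r + 1) : ℕ) : ℤ)).card ≤
        (4 * C + 1) * r := by
      rw [Int.card_Icc, Int.toNat_le]
      push_cast
      have : (1 : ℤ) ≤ r := by exact_mod_cast hr0
      nlinarith [Int.natCast_nonneg C]
    rw [mul_assoc, ← mul_pow]
    refine Nat.mul_le_mul_left _ ((Nat.pow_le_pow_left hcard _).trans ?_)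
    exact Nat.pow_le_pow_right (by positivity) (hd _)
  · obtain ⟨f, hf, w, hw⟩ := hF v
    refine ⟨s (p v) + f, hY _ (fun j => ?_) f hf, w, 0, by simp, ?_⟩
    · rw [Finset.mem_Icc, ← abs_le]
      exact_mod_cast hC r q v hv j
    · rw [hw]; abel

theorem exists_fQ_le {G : Type*} [Group G]
    {n : ℕ} {N : Subgroup G} (hN : N.Normal) [N.FiniteIndex]
    {ι : Multiplicative (Fin n → ℤ) →* G} (hr : ι.range = N)
    {φ : G →* G} {A : G → (Fin n → ℤ) →ₗ[ℤ] (Fin n → ℤ)} (hA : ∀ g, IsTwistMap ι φ g (A g))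
    {d : ℕ} (hd : ∀ g, n - Module.finrank ℤ (LinearMap.range (A g)) ≤ d) :
    ∃ c : ℕ, ∀ k, 0 < k → (twistedClassesMod φ (powSubgroup N k) Set.univ).Finite ∧
      (twistedClassesMod φ (powSubgroup N k) Set.univ).ncard ≤ c * k ^ d := by
  refine exists_ncard_le_mul_pow hN hr hA (powSubgroup N) (powSubgroup_normal hN)
    (fun _ => Set.univ) d fun q => ?_
  obtain ⟨p, s, F, -, -, hF⟩ := exists_split_projection (LinearMap.range (A (Quotient.out q)))
  refine ⟨F.card, fun k hk0 => ?_⟩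
  obtain ⟨Y, hYcard, hY⟩ := exists_image_add_finset s F (Finset.Ico 0 (k : ℤ))
  refine ⟨Y, hYcard.trans ?_, fun v hv => ?_⟩
  · rw [Int.card_Ico]
    exact Nat.mul_le_mul_left _ (by simpa using Nat.pow_le_pow_right hk0 (hd _))
  · obtain ⟨f, hf, w, hw⟩ := hF v
    have hk1 : (0 : ℤ) < k := by exact_mod_cast hk0
    have hsplit : p v = (fun j => p v j % (k : ℤ)) + (k : ℤ) • fun j => p v j / (k : ℤ) := by
      ext j
      simp [Int.emod_add_mul_ediv]
    refine ⟨s (fun j => p v j % (k : ℤ)) + f, hY _ (fun j => ?_) f hf, w,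
      (k : ℤ) • s fun j => p v j / (k : ℤ), (mem_powSubgroup hr k).2 ⟨_, rfl⟩, ?_⟩
    · exact Finset.mem_Ico.2 ⟨Int.emod_nonneg _ hk1.ne', Int.emod_lt_of_pos _ hk1⟩
    · rw [hw]
      nth_rewrite 2 [hsplit]
      rw [map_add, map_smul]
      abel

theorem exists_le_fR {G : Type*} [Group G] {S : Set G} (hS : Subgroup.closure S = ⊤)
    {n : ℕ} {N : Subgroup G} (hN : N.Normal) [N.FiniteIndex]
    {ι : Multiplicative (Fin n → ℤ) →* G} (hι : Function.Injective ι) (hr : ι.range = N)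
    {φ : G →* G} {g : G} {A : (Fin n → ℤ) →ₗ[ℤ] (Fin n → ℤ)} (hA : IsTwistMap ι φ g A)
    (hfin : ∀ r, 0 < r → (twistedClassesMod φ ⊥ (ball S r)).Finite) :
    ∃ c r₀ : ℕ, 0 < c ∧ ∀ r, r₀ < r →
      r ^ (n - Module.finrank ℤ (LinearMap.range A)) ≤
        c * (twistedClassesMod φ ⊥ (ball S r)).ncard := by
  classical
  obtain ⟨p, s, -, hps, hp, -⟩ := exists_split_projection (LinearMap.range A)
  generalize n - Module.finrank ℤ (LinearMap.range A) = d at *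
  obtain ⟨c, hc⟩ := exists_box_mem_ball hS (ι.comp (AddMonoidHom.toMultiplicative s.toAddMonoidHom))
  obtain ⟨t, ht⟩ := exists_mem_ball hS g
  have hinj : Function.Injective s := Function.LeftInverse.injective hps
  refine ⟨(2 * (c + 1)) ^ d * N.index, 2 * t, by
    have := N.index_ne_zero_of_finite
    positivity, fun r hrt => ?_⟩
  set m := (r - t) / (c + 1)
  have hm1 : r ≤ 2 * (c + 1) * (m + 1) := by
    have h1 := Nat.lt_div_mul_add (a := r - t) (Nat.succ_pos c)
    have h2 : r - t < (c + 1) * (m + 1) := by rw [mul_add, mul_comm, mul_one]; exact h1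
    rw [mul_assoc]
    omega
  have hm2 : c * m + t ≤ r := by
    have h1 : m * (c + 1) ≤ r - t := Nat.div_mul_le_self _ _
    have h2 : c * m ≤ m * (c + 1) := by rw [mul_comm c m]; gcongr; omega
    omega
  have h := card_le_index_mul_ncard hN hι hr hA ⊥ bot_le (ball S r) (hfin r (by omega))
    ((Fintype.piFinset fun _ : Fin d => Finset.Icc (0 : ℤ) m).image s) ?_ ?_
  · rw [Finset.card_image_of_injective _ hinj, Fintype.card_piFinset] at h
    simp only [Int.card_Icc, Finset.prod_const, Finset.card_univ, Fintype.card_fin] at h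
    calc r ^ d ≤ (2 * (c + 1) * (m + 1)) ^ d := Nat.pow_le_pow_left hm1 d
      _ = (2 * (c + 1)) ^ d * (m + 1) ^ d := mul_pow _ _ _
      _ ≤ (2 * (c + 1)) ^ d * (N.index * (twistedClassesMod φ ⊥ (ball S r)).ncard) :=
        Nat.mul_le_mul_left _ (by simpa using h)
      _ = _ := (mul_assoc _ _ _).symm
  · intro x hx
    obtain ⟨a, ha, rfl⟩ := Finset.mem_image.1 hx
    refine ball_mono S hm2 (mul_mem_ball (hc m a fun j => ?_) ht)
    exact Finset.mem_Icc.1 (Fintype.mem_piFinset.1 ha j)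
  · intro x hx y hy w k hk hxy
    obtain ⟨a, -, rfl⟩ := Finset.mem_image.1 hx
    obtain ⟨b, -, rfl⟩ := Finset.mem_image.1 hy
    have hk0 : k = 0 := Multiplicative.ofAdd.injective (hι (by simpa using hk))
    have := congrArg p hxy
    rw [hk0, add_zero, map_add, hps, hps, hp _ ⟨w, rfl⟩, add_zero] at this
    rw [this]

theorem pow_le_fQ {G : Type*} [Group G]
    {n : ℕ} {N : Subgroup G} (hN : N.Normal) [N.FiniteIndex]
    {ι : Multiplicative (Fin n → ℤ) →* G} (hι : Function.Injective ι) (hr : ι.range = N)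
    {φ : G →* G} {g : G} {A : (Fin n → ℤ) →ₗ[ℤ] (Fin n → ℤ)} (hA : IsTwistMap ι φ g A)
    {k : ℕ} (hfin : (twistedClassesMod φ (powSubgroup N k) Set.univ).Finite) :
    k ^ (n - Module.finrank ℤ (LinearMap.range A)) ≤
      N.index * (twistedClassesMod φ (powSubgroup N k) Set.univ).ncard := by
  classical
  obtain ⟨p, s, -, hps, hp, -⟩ := exists_split_projection (LinearMap.range A)
  generalize n - Module.finrank ℤ (LinearMap.range A) = d at *
  have hinj : Function.Injective s := Function.LeftInverse.injective hps
  have := powSubgroup_normal hN k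
  have h := card_le_index_mul_ncard hN hι hr hA (powSubgroup N k) (powSubgroup_le N k) Set.univ hfin
    ((Fintype.piFinset fun _ : Fin d => Finset.Ico (0 : ℤ) k).image s) (fun _ _ => trivial) ?_
  · rw [Finset.card_image_of_injective _ hinj, Fintype.card_piFinset] at h
    simpa using h
  · intro x hx y hy w u hu hxy
    obtain ⟨a, ha, rfl⟩ := Finset.mem_image.1 hx
    obtain ⟨b, hb, rfl⟩ := Finset.mem_image.1 hy
    obtain ⟨v, hv⟩ := (mem_powSubgroup hr k).1 hu
    have hu' : u = (k : ℤ) • v := Multiplicative.ofAdd.injective (hι hv)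
    have h1 := congrArg p hxy
    rw [hu', map_add, map_add, hps, hps, hp _ ⟨w, rfl⟩, add_zero, map_smul] at h1
    congr 1
    ext j
    have ha' := Finset.mem_Ico.1 (Fintype.mem_piFinset.1 ha j)
    have hb' := Finset.mem_Ico.1 (Fintype.mem_piFinset.1 hb j)
    have h2 : a j = b j + k * p v j := by rw [h1]; simp
    rw [← Int.emod_eq_of_lt ha'.1 ha'.2, ← Int.emod_eq_of_lt hb'.1 hb'.2, h2,
      Int.add_mul_emod_self_left]

theorem isThetaNat_of_le_mul {f g : ℕ → ℕ} {a b r₀ : ℕ} (ha : 0 < a)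
    (h₁ : ∀ r, r₀ < r → g r ≤ a * f r) (h₂ : ∀ r, 0 < r → f r ≤ b * g r) : IsThetaNat f g := by
  have ha' : (0 : ℝ) < a := by exact_mod_cast ha
  refine ⟨1 / a, b + 1, by positivity, by positivity, r₀ + 1, by omega, fun r hr => ⟨?_, ?_⟩⟩
  · rw [one_div, inv_mul_le_iff₀ ha']
    exact_mod_cast h₁ r (by omega)
  · have : (f r : ℝ) ≤ b * g r := by exact_mod_cast h₂ r (by omega)
    have : (0 : ℝ) ≤ g r := by positivity
    linarith

theorem IsThetaNat.trans_symm {f g h : ℕ → ℕ} (hf : IsThetaNat f h) (hg : IsThetaNat g h) :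
    IsThetaNat f g := by
  obtain ⟨a₁, a₂, ha₁, ha₂, m, hm, hf⟩ := hf
  obtain ⟨b₁, b₂, hb₁, hb₂, l, hl, hg⟩ := hg
  refine ⟨a₁ / b₂, a₂ / b₁, by positivity, by positivity, max m l, by omega, fun r hr => ?_⟩
  obtain ⟨hf₁, hf₂⟩ := hf r (by omega)
  obtain ⟨hg₁, hg₂⟩ := hg r (by omega)
  constructor
  · calc a₁ / b₂ * (g r : ℝ) ≤ a₁ / b₂ * (b₂ * h r) := by gcongr
      _ = a₁ * h r := by field_simp
      _ ≤ f r := hf₁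
  · calc (f r : ℝ) ≤ a₂ * h r := hf₂
      _ = a₂ / b₁ * (b₁ * h r) := by field_simp
      _ ≤ a₂ / b₁ * g r := by gcongr

theorem quasiDomNat_of_isThetaNat {f g h : ℕ → ℕ} (hh : Monotone h) (hf : IsThetaNat f h)
    (hg : IsThetaNat g h) : QuasiDomNat f g := by
  obtain ⟨a₁, a₂, ha₁, ha₂, m, hm, hf⟩ := hf
  obtain ⟨b₁, b₂, hb₁, hb₂, l, hl, hg⟩ := hg
  set c : ℝ := a₂ / b₁ + 1 with hc
  set b : ℕ := l + ∑ i ∈ Finset.range m, f i with hb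
  have hc0 : 0 < a₂ / b₁ := by positivity
  refine ⟨b, c, by rw [hb]; positivity, by positivity, fun r => ?_⟩
  set k := ⌊c * (r : ℝ) + b⌋₊ with hk
  have hrk : r + b ≤ k := by
    rw [hk]
    refine Nat.le_floor ?_
    push_cast
    nlinarith [(Nat.cast_nonneg r : (0 : ℝ) ≤ r)]
  have hb0 : (0 : ℝ) ≤ b := by positivity
  by_cases hrm : m ≤ r
  · have h1 : (f r : ℝ) ≤ a₂ * h r := (hf r hrm).2
    have h2 : b₁ * (h k : ℝ) ≤ g k := (hg k (by omega)).1
    have h3 : (h r : ℝ) ≤ h k := by exact_mod_cast hh (by omega : r ≤ k)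
    have h4 : a₂ * (h r : ℝ) ≤ a₂ / b₁ * g k := by
      calc a₂ * (h r : ℝ) ≤ a₂ * h k := by gcongr
        _ = a₂ / b₁ * (b₁ * h k) := by field_simp
        _ ≤ a₂ / b₁ * g k := by gcongr
    have h5 : (0 : ℝ) ≤ g k := by positivity
    rw [hc, add_mul]
    linarith
  · have h1 : f r ≤ b := by
      have := Finset.single_le_sum (f := f) (fun i _ => Nat.zero_le _)
        (Finset.mem_range.2 (not_le.1 hrm))
      omega
    have h2 : (f r : ℝ) ≤ b := by exact_mod_cast h1
    have h3 : 0 ≤ c * (g k : ℝ) := by positivity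
    linarith

/-- **The twisted conjugacy growth and the quotient growth are quasi-equivalent and both
polynomial of degree `rank(N) − m`.** -/
theorem twisted_conjugacy_and_quotient_growth_equivalent {G : Type*} [Group G]
    (S : Set G) (hSfin : S.Finite) (hSgen : Subgroup.closure S = ⊤)
    (n : ℕ) (N : Subgroup G) (hNnorm : N.Normal) (hNfin : N.FiniteIndex)
    (e : N ≃* Multiplicative (Fin n → ℤ))
    (φ : G →* G) (hφN : ∀ x ∈ N, φ x ∈ N) :
    QuasiEquivNat (fR φ S) (fQ φ N) ∧
    IsThetaNat (fR φ S) (fQ φ N) ∧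
    IsThetaNat (fR φ S) (fun k => k ^ (n - minTwistRank φ N)) ∧
    IsThetaNat (fQ φ N) (fun k => k ^ (n - minTwistRank φ N)) := by
  let ι : Multiplicative (Fin n → ℤ) →* G := N.subtype.comp e.symm.toMonoidHom
  have hι : Function.Injective ι := N.subtype_injective.comp e.symm.injective
  have hr : ι.range = N := by
    rw [MonoidHom.range_comp, MonoidHom.range_eq_top.2 e.symm.surjective, ← MonoidHom.range_eq_map,
      Subgroup.range_subtype]
  choose A hA using fun g => exists_isTwistMap hNnorm hι hr hφN g
  have hrank : ∀ g, grpRank (twistImage φ N g) = Module.finrank ℤ (LinearMap.range (A g)) :=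
    fun g => grpRank_twistImage hι hr (hA g)
  obtain ⟨g, hg⟩ : ∃ g, minTwistRank φ N = Module.finrank ℤ (LinearMap.range (A g)) := by
    obtain ⟨g, hg⟩ := Nat.sInf_mem (s := {m : ℕ | ∃ g : G, m = grpRank (twistImage φ N g)})
      ⟨_, 1, rfl⟩
    exact ⟨g, hg.trans (hrank g)⟩
  have hd : ∀ x, n - Module.finrank ℤ (LinearMap.range (A x)) ≤ n - minTwistRank φ N := fun x =>
    Nat.sub_le_sub_left (hrank x ▸ Nat.sInf_le ⟨x, rfl⟩) n
  obtain ⟨a, ha⟩ := exists_fR_le hSfin hNnorm hι hr hA hd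
  obtain ⟨b, hb⟩ := exists_fQ_le hNnorm hr hA hd
  obtain ⟨c, r₀, hc0, hc⟩ := exists_le_fR hSgen hNnorm hι hr (hA g) fun r h => (ha r h).1
  have hR : IsThetaNat (fR φ S) fun k => k ^ (n - minTwistRank φ N) :=
    isThetaNat_of_le_mul hc0 (fun r h => by rw [fR_eq_ncard, hg]; exact hc r h)
      fun r h => by rw [fR_eq_ncard]; exact (ha r h).2
  have hQ : IsThetaNat (fQ φ N) fun k => k ^ (n - minTwistRank φ N) :=
    isThetaNat_of_le_mul (r₀ := 0) (Nat.pos_of_ne_zero N.index_ne_zero_of_finite)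
      (fun k h => by rw [fQ_eq_ncard, hg]; exact pow_le_fQ hNnorm hι hr (hA g) (hb k h).1)
      fun k h => by rw [fQ_eq_ncard]; exact (hb k h).2
  have hmono : Monotone fun k : ℕ => k ^ (n - minTwistRank φ N) := fun _ _ h =>
    Nat.pow_le_pow_left h _
  exact ⟨⟨quasiDomNat_of_isThetaNat hmono hR hQ, quasiDomNat_of_isThetaNat hmono hQ hR⟩,
    hR.trans_symm hQ, hR, hQ⟩
end

section
/- Let G be a finitely generated virtually abelian group, N ⊴_fin G a torsion-free abelian normal subgroup of finite index, and φ ∈ End(G) with φ(N) ⊆ N. Fix a finite set A ⊆ G of coset representatives of G/N containing 1_G. Suppose moreover that G/N is abelian and the endomorphism φ̄ induced by φ on G/N is the identity. Then for any a, b ∈ A and any x, y ∈ N: xa is φ-twisted conjugate to yb in G if and only if a = b and x ∈ ⋃_{c ∈ A} ( τ_c(y) − (τ_a ∘ φ^a)(c) + Im(Id_N − (τ_a ∘ φ)|_N) ), where the arithmetic takes place in the abelian group N written additively. -/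
open Filter Topology
open scoped Pointwise NNReal

/-- For `N` abelian, normal and `φ`-invariant, the image of `Id_N - (τ_g ∘ φ)|_N` is already
a subgroup, so `twistImage φ N g` has no further elements. -/
theorem mem_twistImage_iff {G : Type*} [Group G] {φ : G →* G} {N : Subgroup G}
    (hNnorm : N.Normal) (hNab : ∀ x ∈ N, ∀ y ∈ N, x * y = y * x)
    (hφN : ∀ x ∈ N, φ x ∈ N) {g u : G} :
    u ∈ twistImage φ N g ↔ ∃ n ∈ N, u = n * (g * φ n * g⁻¹)⁻¹ := by
  refine ⟨fun hu => ?_, fun hu => Subgroup.subset_closure hu⟩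
  have hconj (n : G) (hn : n ∈ N) : g * φ n * g⁻¹ ∈ N := hNnorm.conj_mem _ (hφN n hn) g
  induction hu using Subgroup.closure_induction with
  | mem u hu => exact hu
  | one => exact ⟨1, N.one_mem, by simp⟩
  | mul u v _ _ hu hv =>
    obtain ⟨m, hm, rfl⟩ := hu
    obtain ⟨n, hn, rfl⟩ := hv
    refine ⟨m * n, N.mul_mem hm hn, ?_⟩
    have hcomm := hNab _ (N.inv_mem (hconj m hm)) _
      (N.mul_mem hn (N.inv_mem (hconj n hn)))
    rw [mul_assoc m, hcomm, map_mul]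
    group
  | inv u _ hu =>
    obtain ⟨n, hn, rfl⟩ := hu
    refine ⟨n⁻¹, N.inv_mem hn, ?_⟩
    rw [mul_inv_rev, inv_inv, hNab _ (hconj n hn) _ (N.inv_mem hn), map_inv]
    group

/-- If `G/N` is abelian and `φ` induces the identity on it, then `φ`-twisted conjugate elements
lie in the same coset of `N`. -/
theorem TwistedConj.inv_mul_mem {G : Type*} [Group G] {φ : G →* G} {N : Subgroup G}
    (hNnorm : N.Normal) (hGNab : ∀ g h : G, g * h * g⁻¹ * h⁻¹ ∈ N)
    (hφbar : ∀ g : G, g⁻¹ * φ g ∈ N) {x y : G} (h : TwistedConj φ x y) : x⁻¹ * y ∈ N := by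
  obtain ⟨z, rfl⟩ := h
  have hcomm : z * (y⁻¹ * z⁻¹ * y * z) * z⁻¹ ∈ N :=
    hNnorm.conj_mem _ (by simpa using hGNab y⁻¹ z⁻¹) z
  have hφz : z * (z⁻¹ * φ z) * z⁻¹ ∈ N := hNnorm.conj_mem _ (hφbar z) z
  convert N.mul_mem hφz hcomm using 1
  group

/-- **Twisted conjugacy when `G/N` is abelian and `φ̄ = Id_{G/N}`**: `xa ∼_φ yb` iff `a = b` and
`x` lies in the stated finite union of cosets; multiplicative notation is used for the
arithmetic in the abelian group `N`. -/
theorem twisted_conjugacy_abelian_quotient_identity {G : Type*} [Group G] (hG : Group.FG G)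
    (N : Subgroup G) (hNnorm : N.Normal) (hNfin : N.FiniteIndex)
    (hNab : ∀ x ∈ N, ∀ y ∈ N, x * y = y * x)
    (hNtf : ∀ x ∈ N, ∀ k : ℕ, 0 < k → x ^ k = 1 → x = 1)
    (φ : G →* G) (hφN : ∀ x ∈ N, φ x ∈ N)
    (A : Finset G) (hA1 : (1 : G) ∈ A)
    (hArep : ∀ g : G, ∃ a ∈ A, a⁻¹ * g ∈ N)
    (hAuniq : ∀ a ∈ A, ∀ b ∈ A, a⁻¹ * b ∈ N → a = b)
    (hGNab : ∀ g h : G, g * h * g⁻¹ * h⁻¹ ∈ N)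
    (hφbar : ∀ g : G, g⁻¹ * φ g ∈ N)
    (a : G) (ha : a ∈ A) (b : G) (hb : b ∈ A)
    (x y : G) (hx : x ∈ N) (hy : y ∈ N) :
    TwistedConj φ (x * a) (y * b) ↔
      (a = b ∧ ∃ c ∈ A, ∃ u ∈ twistImage φ N a,
        x = (c * y * c⁻¹) * (a * φ c * a⁻¹ * c⁻¹)⁻¹ * u) := by
  have hfactor (n c : G) : n * c * (y * a) * (φ (n * c))⁻¹ =
      n * ((c * y * c⁻¹) * (a * φ c * a⁻¹ * c⁻¹)⁻¹) * (a * φ n * a⁻¹)⁻¹ * a := by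
    rw [map_mul]
    group
  have hmem (c : G) : (c * y * c⁻¹) * (a * φ c * a⁻¹ * c⁻¹)⁻¹ ∈ N := by
    refine N.mul_mem (hNnorm.conj_mem _ hy c) (N.inv_mem ?_)
    convert N.mul_mem (hGNab a c) (hNnorm.conj_mem _ (hφbar c) (c * a)) using 1
    group
  constructor
  · intro h
    have hab : a = b := by
      refine hAuniq a ha b hb ?_
      have hxy := TwistedConj.inv_mul_mem hNnorm hGNab hφbar h
      have hyx : a⁻¹ * (y⁻¹ * x) * a ∈ N := by
        simpa using hNnorm.conj_mem _ (N.mul_mem (N.inv_mem hy) hx) a⁻¹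
      convert N.mul_mem hyx hxy using 1
      group
    subst hab
    obtain ⟨z, hz⟩ := h
    obtain ⟨c, hc, hcz⟩ := hArep z
    obtain ⟨n, hn, rfl⟩ : ∃ n ∈ N, z = n * c :=
      ⟨z * c⁻¹, by simpa [mul_assoc] using hNnorm.conj_mem _ hcz c, by group⟩
    refine ⟨rfl, c, hc, n * (a * φ n * a⁻¹)⁻¹,
      (mem_twistImage_iff hNnorm hNab hφN).2 ⟨n, hn, rfl⟩, ?_⟩
    rw [hfactor, mul_left_inj, hNab n hn _ (hmem c)] at hz
    rw [hz, mul_assoc]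
  · rintro ⟨rfl, c, -, u, hu, hxu⟩
    obtain ⟨n, hn, rfl⟩ := (mem_twistImage_iff hNnorm hNab hφN).1 hu
    refine ⟨n * c, ?_⟩
    rw [hfactor, hNab n hn _ (hmem c), hxu, mul_assoc _ n]
end
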